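/- If u ∈ S_n factors as u = u_1 u_2 where u_1, u_2 have positive length, the sets of simple reflections occurring in reduced expressions of u_1 and of u_2 are disjoint, and every simple reflection used in u_1 commutes with every simple reflection used in u_2, then the product of Schubert classes satisfies σ^{u_1} ∪ σ^{u_2} = σ^{u}; equivalently N_{u_1,u_2}^{u_1 u_2} = 1 and N_{u_1,u_2}^w = 0 for all w ≠ u_1 u_2. -/

import Mathlib

/-- The symmetric group `S_n`, realized as permutations of `Fin n`. -/
abbrev Sn (n : ℕ) := Equiv.Perm (Fin n)

/-- The Coxeter length of a permutation: its number of inversions. -/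
noncomputable def len {n : ℕ} (u : Sn n) : ℕ :=
  Set.ncard {p : Fin n × Fin n | p.1 < p.2 ∧ u p.2 < u p.1}

/-- The simple transposition `s_{r+1} = (r+1, r+2)` (0-indexed: swapping `r` and `r+1`). -/
def simpleRefl (n r : ℕ) (h : r + 1 < n) : Sn n :=
  Equiv.swap ⟨r, by omega⟩ ⟨r + 1, h⟩

open Classical in
/-- `N` is the family of Schubert structure constants of `H^*(Fℓ_n, ℤ)`: there is a
commutative ring with a linearly independent family `(σ^u)_{u ∈ S_n}` of Schubert classes,
with `σ^{id} = 1`, products `σ^u ∪ σ^v = Σ_w N_{u,v}^w σ^w` graded by length, satisfying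
Monk's rule for multiplication by the divisor classes `σ^{s_r}` (which characterizes the
cohomology ring of the complete flag variety together with its Schubert basis). -/
def IsSchubertConstants (n : ℕ) (N : Sn n → Sn n → Sn n → ℤ) : Prop :=
  ∃ (A : Type) (_ : CommRing A) (σ : Sn n → A),
    LinearIndependent ℤ σ ∧ σ 1 = 1 ∧
    (∀ u v : Sn n, σ u * σ v = ∑ w : Sn n, N u v w • σ w) ∧
    (∀ u v w : Sn n, N u v w ≠ 0 → len w = len u + len v) ∧
    (∀ (r : ℕ) (h : r + 1 < n) (u : Sn n),
      σ (simpleRefl n r h) * σ u =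
        ∑ w : Sn n, (if ∃ a b : Fin n, a.val ≤ r ∧ r < b.val ∧
            w = u * Equiv.swap a b ∧ len w = len u + 1 then (1 : ℤ) else 0) • σ w)

/-- The simple reflection `s_i` indexed by `i : Fin (n-1)`. -/
def sref (n : ℕ) (i : Fin (n - 1)) : Sn n :=
  Equiv.swap ⟨i.val, by have := i.isLt; omega⟩ ⟨i.val + 1, by have := i.isLt; omega⟩

/-- `L` is a reduced word for `u`: a word in the simple reflections of length `ℓ(u)` whose
product is `u`. -/
def IsReducedWord (n : ℕ) (u : Sn n) (L : List (Fin (n - 1))) : Prop :=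
  len u = L.length ∧ u = (L.map (sref n)).prod


namespace SchubAux

open Classical

variable {n : ℕ}

/-- inversion set -/
def inv (u : Sn n) : Set (Fin n × Fin n) := {p | p.1 < p.2 ∧ u p.2 < u p.1}

theorem swap_lt {i j : Fin n} (hij : i.val + 1 = j.val) {a b : Fin n} (hab : a < b)
    (h : ¬ (a = i ∧ b = j)) : Equiv.swap i j a < Equiv.swap i j b := by
  simp only [Equiv.swap_apply_def]
  split_ifs <;> simp only [Fin.lt_def, Fin.ext_iff] at * <;> omega

theorem len_up {u : Sn n} {i j : Fin n} (hij : i.val + 1 = j.val) (h : u i < u j) :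
    len (u * Equiv.swap i j) = len u + 1 := by
  have hlt : i < j := by rw [Fin.lt_def]; omega
  have e : inv (u * Equiv.swap i j) =
      insert (i, j) ((Prod.map (Equiv.swap i j) (Equiv.swap i j)) '' (inv u)) := by
    ext ⟨a, b⟩
    simp only [inv, Set.mem_ofPred_eq, Set.mem_insert_iff, Set.mem_image, Prod.exists,
      Prod.map_apply, Prod.mk.injEq, Equiv.Perm.mul_apply]
    constructor
    · rintro ⟨h1, h2⟩
      by_cases hh : a = i ∧ b = j
      · exact Or.inl hh
      · exact Or.inr ⟨Equiv.swap i j a, Equiv.swap i j b, ⟨swap_lt hij h1 hh, h2⟩, by simp, by simp⟩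
    · rintro (⟨rfl, rfl⟩ | ⟨c, d, ⟨h1, h2⟩, rfl, rfl⟩)
      · simpa using ⟨hlt, h⟩
      · refine ⟨swap_lt hij h1 ?_, by simpa using h2⟩
        rintro ⟨rfl, rfl⟩
        exact absurd h2 (not_lt.2 h.le)
  have hni : (i, j) ∉ ((Prod.map (Equiv.swap i j) (Equiv.swap i j)) '' (inv u)) := by
    rintro ⟨⟨c, d⟩, ⟨h1, h2⟩, h3⟩
    simp only [Prod.map_apply, Prod.mk.injEq] at h3
    have hc : c = j := by
      have := congrArg (Equiv.swap i j) h3.1; simpa using this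
    have hd : d = i := by
      have := congrArg (Equiv.swap i j) h3.2; simpa using this
    subst hc hd
    exact absurd h1 (not_lt.2 hlt.le)
  change (inv _).ncard = (inv u).ncard + 1
  rw [e, Set.ncard_insert_of_notMem hni, Set.ncard_image_of_injective]
  exact (Equiv.swap i j).injective.prodMap (Equiv.swap i j).injective

theorem len_down {u : Sn n} {i j : Fin n} (hij : i.val + 1 = j.val) (h : u j < u i) :
    len u = len (u * Equiv.swap i j) + 1 := by
  have := len_up (u := u * Equiv.swap i j) hij (by simpa using h)
  simpa [mul_assoc] using this

theorem ne_of_succ {i j : Fin n} (hij : i.val + 1 = j.val) : i ≠ j := by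
  rintro rfl; omega

theorem len_cases (u : Sn n) {i j : Fin n} (hij : i.val + 1 = j.val) :
    (u i < u j ∧ len (u * Equiv.swap i j) = len u + 1) ∨
    (u j < u i ∧ len u = len (u * Equiv.swap i j) + 1) := by
  rcases lt_or_gt_of_ne (u.injective.ne (ne_of_succ hij)) with h | h
  · exact Or.inl ⟨h, len_up hij h⟩
  · exact Or.inr ⟨h, len_down hij h⟩

theorem len_swap_lt (d : ℕ) : ∀ (u : Sn n) (a b : Fin n), a.val + d + 1 = b.val → u a < u b →
    len u < len (u * Equiv.swap a b) := by
  induction d with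
  | zero => intro u a b h hu; rw [len_up (by omega) hu]; omega
  | succ d ih =>
    intro u a b h hu
    have hbn := b.isLt
    obtain ⟨c, hc⟩ : ∃ c : Fin n, a.val + 1 = c.val := ⟨⟨a.val + 1, by omega⟩, rfl⟩
    have hab : a ≠ b := by rintro rfl; omega
    have hcb : c ≠ b := by rintro rfl; omega
    have hac := ne_of_succ hc
    have h1 := ih (u * Equiv.swap a c) c b (by omega)
      (by simpa [Equiv.swap_apply_of_ne_of_ne hab.symm hcb.symm] using hu)
    have e : u * Equiv.swap a c * Equiv.swap c b * Equiv.swap a c = u * Equiv.swap a b := by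
      rw [mul_assoc, mul_assoc]
      congr 1
      rw [Equiv.swap_comm a c, Equiv.swap_comm c b, ← mul_assoc,
        Equiv.swap_mul_swap_mul_swap hcb.symm hab.symm]
    have h2 := len_cases u hc
    have h3 := len_cases (u * Equiv.swap a c * Equiv.swap c b) hc
    rw [e] at h3
    simp only [Equiv.Perm.mul_apply, Equiv.swap_apply_left,
      Equiv.swap_apply_of_ne_of_ne hac hab, Equiv.swap_apply_of_ne_of_ne hab.symm hcb.symm] at h3
    rcases h2 with ⟨h2, h2'⟩ | ⟨h2, h2'⟩
    · omega
    · rcases h3 with ⟨h3, h3'⟩ | ⟨h3, h3'⟩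
      · omega
      · exact absurd (h3.trans h2) (not_lt.2 hu.le)

theorem len_swap_lt' {u : Sn n} {a b : Fin n} (hab : a < b) (hu : u a < u b) :
    len u < len (u * Equiv.swap a b) :=
  len_swap_lt (b.val - a.val - 1) u a b (by rw [Fin.lt_def] at hab; omega) hu

theorem cover_lt {u : Sn n} {a b : Fin n} (hab : a < b)
    (h : len (u * Equiv.swap a b) = len u + 1) : u a < u b := by
  by_contra hc
  have := len_swap_lt' (u := u * Equiv.swap a b) hab (by
    simpa using lt_of_le_of_ne (not_lt.1 hc) (u.injective.ne hab.ne').symm.symm)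
  simp [mul_assoc] at this
  omega

theorem cover_between {u : Sn n} {a b c : Fin n} (hac : a < c) (hcb : c < b)
    (h : len (u * Equiv.swap a b) = len u + 1) (h1 : u a < u c) (h2 : u c < u b) : False := by
  have hab := hac.trans hcb
  have k1 := len_swap_lt' hac h1
  have k2 := len_swap_lt' (u := u * Equiv.swap a c) hcb (by
    simpa [Equiv.swap_apply_of_ne_of_ne hab.ne' hcb.ne'] using h1.trans h2)
  have e : u * Equiv.swap a c * Equiv.swap c b * Equiv.swap a c = u * Equiv.swap a b := by
    rw [mul_assoc, mul_assoc]
    congr 1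
    rw [Equiv.swap_comm a c, Equiv.swap_comm c b, ← mul_assoc,
      Equiv.swap_mul_swap_mul_swap hcb.ne' hab.ne']
  have k3 := len_swap_lt' (u := u * Equiv.swap a c * Equiv.swap c b) hac (by
    simpa [Equiv.swap_apply_of_ne_of_ne hab.ne' hcb.ne',
      Equiv.swap_apply_of_ne_of_ne hac.ne hab.ne] using h2)
  rw [e] at k3
  omega

/-- an ascent of `u` which becomes a descent after a cover must be the cover itself -/
theorem cover_key {u : Sn n} {i j k l : Fin n} (hij : i.val + 1 = j.val) (hkl : k < l)
    (h : len (u * Equiv.swap k l) = len u + 1) (h1 : u i < u j)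
    (h2 : u (Equiv.swap k l j) < u (Equiv.swap k l i)) : k = i ∧ l = j := by
  have hu := cover_lt hkl h
  have hb := fun c h1 h2 => cover_between (c := c) h1 h2 h
  have hi := hb i
  have hj := hb j
  simp only [Equiv.swap_apply_def] at h2
  split_ifs at h2 <;> subst_vars <;> simp only [Fin.lt_def, Fin.ext_iff] at * <;> try omega
  all_goals grind

theorem len_one : len (1 : Sn n) = 0 := by
  unfold len
  rw [Set.ncard_eq_zero]
  ext ⟨a, b⟩
  simp only [Set.mem_ofPred_eq, Set.mem_empty_iff_false, iff_false, Equiv.Perm.one_apply]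
  rintro ⟨h1, h2⟩
  exact absurd h1 (not_lt.2 h2.le)

theorem exists_descent {u : Sn n} (hu : u ≠ 1) :
    ∃ i j : Fin n, i.val + 1 = j.val ∧ u j < u i := by
  by_contra hc
  push Not at hc
  apply hu
  have hm : StrictMono u := by
    cases n with
    | zero => intro a; exact a.elim0
    | succ m =>
      rw [Fin.strictMono_iff_lt_succ]
      intro i
      exact lt_of_le_of_ne (hc _ _ (by simp)) (u.injective.ne (ne_of_succ (by simp)))
  ext a
  have := Subsingleton.elim (hm.orderIsoOfSurjective u u.surjective) (OrderIso.refl _)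
  have h2 := congrArg (fun f => f a) this
  simpa using congrArg Fin.val h2

theorem eq_one_of_len {u : Sn n} (h : len u = 0) : u = 1 := by
  by_contra hu
  obtain ⟨i, j, hij, hd⟩ := exists_descent hu
  have := len_down hij hd
  omega

/-- signed cover coefficient -/
noncomputable def coef (u : Sn n) (k l : Fin n) : ℤ :=
  if len (u * Equiv.swap k l) = len u + 1 then (if k < l then 1 else if l < k then -1 else 0) else 0

theorem coef_self (u : Sn n) (k : Fin n) : coef u k k = 0 := by simp [coef]

section alg

variable {S : Type} [CommRing S] (b : Module.Basis (Sn n) ℤ S) (x : Fin n → S)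

/-- divided difference -/
noncomputable def dd (i j : Fin n) : S →ₗ[ℤ] S :=
  b.constr ℤ (fun w => if w j < w i then b (w * Equiv.swap i j) else 0)

theorem dd_b (i j : Fin n) (w : Sn n) :
    dd b i j (b w) = if w j < w i then b (w * Equiv.swap i j) else 0 := by
  rw [dd, Module.Basis.constr_basis]

theorem swap_conj (u : Sn n) (i j k l : Fin n) :
    u * Equiv.swap i j * Equiv.swap (Equiv.swap i j k) (Equiv.swap i j l) =
      u * Equiv.swap k l * Equiv.swap i j := by
  rw [mul_assoc, mul_assoc, Equiv.mul_swap_eq_swap_mul]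
  simp

theorem term_aux {i j : Fin n} (hij : i.val + 1 = j.val) (u : Sn n) {k l : Fin n} (hkl : k < l)
    (hne : ¬ (k = i ∧ l = j)) :
    (len (u * Equiv.swap k l) = len u + 1 ∧
      (u * Equiv.swap k l) j < (u * Equiv.swap k l) i) ↔
    (u j < u i ∧ len (u * Equiv.swap k l * Equiv.swap i j) = len (u * Equiv.swap i j) + 1) := by
  have c1 := len_cases u hij
  have c2 := len_cases (u * Equiv.swap k l) hij
  constructor
  · rintro ⟨h1, h2⟩
    have h3 : u j < u i := by
      by_contra h3
      refine hne (cover_key hij hkl h1 ?_ h2)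
      rcases c1 with c1 | c1
      · exact c1.1
      · exact absurd c1.1 h3
    refine ⟨h3, ?_⟩
    rcases c1 with c1 | c1
    · exact absurd c1.1 (not_lt.2 h3.le)
    rcases c2 with c2 | c2
    · exact absurd c2.1 (not_lt.2 h2.le)
    omega
  · rintro ⟨h1, h2⟩
    rcases c1 with c1 | c1
    · exact absurd c1.1 (not_lt.2 h1.le)
    rcases c2 with c2 | c2
    · exfalso
      apply hne
      refine cover_key (u := u * Equiv.swap k l) hij hkl ?_ c2.1 (by simpa using h1)
      have : len (u * Equiv.swap k l * Equiv.swap k l) = len u := by simp [mul_assoc]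
      omega
    · exact ⟨by omega, c2.1⟩

theorem term_lt {i j : Fin n} (hij : i.val + 1 = j.val) (u : Sn n) {k l : Fin n} (hkl : k < l) :
    (if (u * Equiv.swap k l) j < (u * Equiv.swap k l) i then coef u k l else 0) =
    (if u j < u i then coef (u * Equiv.swap i j) (Equiv.swap i j k) (Equiv.swap i j l) else 0)
      + (if k = i ∧ l = j then 1 else if k = j ∧ l = i then -1 else 0) := by
  by_cases hne : k = i ∧ l = j
  · obtain ⟨rfl, rfl⟩ := hne
    have c1 := len_cases u hij
    rcases c1 with ⟨c, d⟩ | ⟨c, d⟩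
    · simp [coef, hkl, c, c.not_gt, d]
    · simp [coef, hkl, c, c.not_gt, ← d, mul_assoc, hkl.not_gt, Equiv.swap_comm l k]
  · have h2 : ¬ (k = j ∧ l = i) := by
      rintro ⟨rfl, rfl⟩; rw [Fin.lt_def] at hkl; omega
    have h3 := swap_lt hij hkl hne
    have h4 := term_aux hij u hkl hne
    rw [if_neg hne, if_neg h2, add_zero]
    simp only [coef, swap_conj, if_pos hkl, if_pos h3]
    rw [← ite_and, ← ite_and]
    exact if_congr ((and_comm).trans h4) rfl rfl

theorem coef_symm (u : Sn n) (k l : Fin n) : coef u k l = - coef u l k := by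
  unfold coef
  rw [Equiv.swap_comm k l]
  rcases lt_trichotomy k l with h | h | h
  · simp [h, h.not_gt]; split_ifs <;> simp
  · simp [h]
  · simp [h, h.not_gt]; split_ifs <;> simp

theorem term_all {i j : Fin n} (hij : i.val + 1 = j.val) (u : Sn n) (k l : Fin n) :
    (if (u * Equiv.swap k l) j < (u * Equiv.swap k l) i then coef u k l else 0) =
    (if u j < u i then coef (u * Equiv.swap i j) (Equiv.swap i j k) (Equiv.swap i j l) else 0)
      + (if k = i ∧ l = j then 1 else if k = j ∧ l = i then -1 else 0) := by
  have hne := ne_of_succ hij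
  rcases lt_trichotomy k l with h | h | h
  · exact term_lt hij u h
  · subst h
    have h1 : ¬ (k = i ∧ k = j) := by rintro ⟨rfl, rfl⟩; exact hne rfl
    have h2 : ¬ (k = j ∧ k = i) := by rintro ⟨rfl, rfl⟩; exact hne rfl
    simp [coef_self, h1, h2]
  · have := term_lt hij u h
    rw [Equiv.swap_comm k l, coef_symm u k l,
      coef_symm _ (Equiv.swap i j k) (Equiv.swap i j l)]
    have e1 : (if k = i ∧ l = j then (1 : ℤ) else if k = j ∧ l = i then -1 else 0) =
      - (if l = i ∧ k = j then 1 else if l = j ∧ k = i then -1 else 0) := by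
      by_cases a1 : k = i ∧ l = j
      · obtain ⟨rfl, rfl⟩ := a1; simp [hne.symm]
      · by_cases a2 : k = j ∧ l = i
        · obtain ⟨rfl, rfl⟩ := a2; simp [hne.symm]
        · rw [if_neg a1, if_neg a2, if_neg (by tauto), if_neg (by tauto)]; simp
    rw [e1]
    split_ifs at this ⊢ <;> linarith

theorem dd_x_b
    (hx : ∀ k u, x k * b u = ∑ l, coef u k l • b (u * Equiv.swap k l))
    {i j : Fin n} (hij : i.val + 1 = j.val) (u : Sn n) (k : Fin n) :
    dd b i j (x k * b u) = x (Equiv.swap i j k) * dd b i j (b u) +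
      (if k = i then (1 : ℤ) else if k = j then -1 else 0) • b u := by
  have hne := ne_of_succ hij
  have hR : x (Equiv.swap i j k) * dd b i j (b u) = ∑ l, (if u j < u i then
      coef (u * Equiv.swap i j) (Equiv.swap i j k) (Equiv.swap i j l) else 0) •
        b (u * Equiv.swap k l * Equiv.swap i j) := by
    rw [dd_b]
    split_ifs
    · rw [hx, ← Equiv.sum_comp (Equiv.swap i j)]
      simp only [swap_conj]
    · simp
  have hC : (if k = i then (1 : ℤ) else if k = j then -1 else 0) • b u =
      ∑ l, (if k = i ∧ l = j then (1 : ℤ) else if k = j ∧ l = i then -1 else 0) •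
        b (u * Equiv.swap k l * Equiv.swap i j) := by
    by_cases h1 : k = i
    · subst h1
      rw [Finset.sum_eq_single j]
      · simp [mul_assoc]
      · intro l _ hl; simp [hl, hne]
      · simp
    · by_cases h2 : k = j
      · subst h2
        rw [Finset.sum_eq_single i]
        · simp [mul_assoc, hne.symm, Equiv.swap_comm k i]
        · intro l _ hl; simp [hl, hne.symm]
        · simp
      · simp [h1, h2]
  rw [hR, hC, ← Finset.sum_add_distrib, hx, map_sum]
  refine Finset.sum_congr rfl fun l _ => ?_
  rw [← add_smul, ← term_all hij, map_smul, dd_b]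
  split_ifs <;> simp

theorem dd_x
    (hx : ∀ k u, x k * b u = ∑ l, coef u k l • b (u * Equiv.swap k l))
    {i j : Fin n} (hij : i.val + 1 = j.val) (k : Fin n) (g : S) :
    dd b i j (x k * g) = x (Equiv.swap i j k) * dd b i j g +
      (if k = i then (1 : ℤ) else if k = j then -1 else 0) • g := by
  set c := (if k = i then (1 : ℤ) else if k = j then -1 else 0) with hc
  have : (dd b i j) ∘ₗ (LinearMap.mulLeft ℤ (x k)) =
      (LinearMap.mulLeft ℤ (x (Equiv.swap i j k))) ∘ₗ (dd b i j) + c • LinearMap.id := by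
    refine b.ext fun u => ?_
    exact dd_x_b b x hx hij u k
  exact congrArg (fun f => f g) this

/-- ordering for the transition induction -/
def key (w : Sn n) : Lex (Fin n → Fin n) := toLex (fun v => w⁻¹ (Fin.rev v))

theorem key_lt {w w' : Sn n} (m : Fin n) (h1 : ∀ v, m < v → w⁻¹ v = w'⁻¹ v)
    (h2 : w⁻¹ m < w'⁻¹ m) : key w < key w' := by
  refine ⟨Fin.rev m, fun j hj => ?_, ?_⟩
  · exact h1 _ (by rwa [← Fin.rev_lt_rev, Fin.rev_rev])
  · simpa [key] using h2

theorem key_step {w : Sn n} {i j l : Fin n} (hij : i.val + 1 = j.val) (hd : w j < w i)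
    (hl : l ≠ j) (hc : coef (w * Equiv.swap i j) i l ≠ 0) :
    key w < key (w * Equiv.swap i j * Equiv.swap i l) := by
  have hne := ne_of_succ hij
  have hli : l ≠ i := by rintro rfl; exact hc (coef_self _ _)
  have hcov : len (w * Equiv.swap i j * Equiv.swap i l) = len (w * Equiv.swap i j) + 1 := by
    by_contra h; exact hc (by simp [coef, h])
  have hwl : w l < w i := by
    rcases lt_or_gt_of_ne hli with h | h
    · have := cover_lt h (by rwa [Equiv.swap_comm l i])
      simp [Equiv.swap_apply_of_ne_of_ne hli hl] at this
      exact this.trans hd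
    · have hjl : j < l := by
        simp only [Fin.lt_def, Fin.ext_iff, ne_eq] at *; omega
      have hi : i < j := by rw [Fin.lt_def]; omega
      by_contra h'
      have h3 : w i < w l := lt_of_le_of_ne (not_lt.1 h') (w.injective.ne hli.symm)
      exact cover_between hi hjl hcov (by simpa using hd)
        (by simpa [Equiv.swap_apply_of_ne_of_ne hli hl] using h3)
  refine key_lt (w i) (fun v hv => ?_) ?_
  · have a1 : w⁻¹ v ≠ i := by rintro h; rw [← h] at hv; simp at hv
    have a2 : w⁻¹ v ≠ j := by
      rintro h; rw [← h] at hd; simp at hd; exact absurd hd (not_lt.2 hv.le)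
    have a3 : w⁻¹ v ≠ l := by
      rintro h; rw [← h] at hwl; simp at hwl; exact absurd hwl (not_lt.2 hv.le)
    rw [mul_inv_rev, mul_inv_rev, Equiv.swap_inv, Equiv.swap_inv, Equiv.Perm.mul_apply,
      Equiv.Perm.mul_apply, Equiv.swap_apply_of_ne_of_ne a1 a2,
      Equiv.swap_apply_of_ne_of_ne a1 a3]
  · simp [mul_inv_rev, Equiv.swap_inv, Equiv.Perm.mul_apply,
      Equiv.swap_apply_of_ne_of_ne hne.symm hl.symm]
    rw [Fin.lt_def]; omega

theorem gen_aux
    (hx : ∀ k u, x k * b u = ∑ l, coef u k l • b (u * Equiv.swap k l))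
    (h1 : b 1 = 1) (m : ℕ) : ∀ w : Sn n, len w = m →
    b w ∈ Algebra.adjoin ℤ (Set.range x) := by
  induction m with
  | zero =>
    intro w hw
    rw [eq_one_of_len hw, h1]
    exact one_mem _
  | succ m ih =>
    intro w
    induction w using (InvImage.wf (key (n := n)) (wellFounded_gt)).induction with
    | _ w ihw =>
    intro hw
    have hw1 : w ≠ 1 := by rintro rfl; rw [len_one] at hw; omega
    obtain ⟨i, j, hij, hd⟩ := exists_descent hw1
    have hlen := len_down hij hd
    have hxx := hx i (w * Equiv.swap i j)
    rw [← Finset.add_sum_erase _ _ (Finset.mem_univ j)] at hxx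
    have hi : i < j := by rw [Fin.lt_def]; omega
    have hcj : coef (w * Equiv.swap i j) i j = 1 := by
      simp [coef, mul_assoc, ← hlen, hi]
    rw [hcj] at hxx
    simp only [mul_assoc, Equiv.swap_mul_self, mul_one, one_smul] at hxx
    rw [← sub_eq_iff_eq_add] at hxx
    rw [← hxx]
    refine sub_mem (mul_mem (Algebra.subset_adjoin ⟨i, rfl⟩) (ih _ (by omega))) ?_
    refine sum_mem fun l hl => ?_
    by_cases hc : coef (w * Equiv.swap i j) i l = 0
    · rw [hc, zero_smul]; exact zero_mem _
    · refine Subalgebra.smul_mem _ ?_ _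
      rw [← mul_assoc]
      refine ihw _ (key_step hij hd (Finset.ne_of_mem_erase hl) hc) ?_
      have : len (w * Equiv.swap i j * Equiv.swap i l) = len (w * Equiv.swap i j) + 1 := by
        by_contra h; exact hc (by simp [coef, h])
      omega

theorem gen
    (hx : ∀ k u, x k * b u = ∑ l, coef u k l • b (u * Equiv.swap k l))
    (h1 : b 1 = 1) (f : S) : f ∈ Algebra.adjoin ℤ (Set.range x) := by
  rw [← b.sum_repr f]
  exact sum_mem fun w _ => Subalgebra.smul_mem _ (gen_aux b x hx h1 _ w rfl) _

theorem leibniz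
    (hx : ∀ k u, x k * b u = ∑ l, coef u k l • b (u * Equiv.swap k l))
    (h1 : b 1 = 1) {i j : Fin n} (hij : i.val + 1 = j.val) (f : S) : ∀ g : S,
    dd b i j (f * g) = dd b i j f * g + (f - (x i - x j) * dd b i j f) * dd b i j g := by
  have hne := ne_of_succ hij
  have hd1 : dd b i j 1 = 0 := by
    rw [← h1, dd_b, if_neg]
    rw [Fin.lt_def]; simp; omega
  induction gen b x hx h1 f using Algebra.adjoin_induction with
  | mem y hy =>
    obtain ⟨k, rfl⟩ := hy
    intro g
    have hk := dd_x b x hx hij k 1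
    rw [mul_one, hd1, mul_zero, zero_add] at hk
    rw [dd_x b x hx hij, hk]
    by_cases a1 : k = i
    · subst a1; simp; ring
    · by_cases a2 : k = j
      · subst a2; simp [hne.symm]; ring
      · simp [a1, a2, Equiv.swap_apply_of_ne_of_ne a1 a2]
  | algebraMap r =>
    intro g
    have : (algebraMap ℤ S r) = r • (1 : S) := by simp
    rw [this, map_smul, hd1, smul_mul_assoc, one_mul, map_smul]
    simp
  | add y z _ _ hy hz =>
    intro g
    rw [add_mul, map_add, hy, hz, map_add]; ring
  | mul y z _ _ hy hz =>
    intro g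
    rw [mul_assoc, hy, hz, hy z]; ring

theorem leibniz'
    (hx : ∀ k u, x k * b u = ∑ l, coef u k l • b (u * Equiv.swap k l))
    (h1 : b 1 = 1) {i j : Fin n} (hij : i.val + 1 = j.val) (f g : S)
    (hg : dd b i j g = 0) : dd b i j (f * g) = dd b i j f * g := by
  rw [leibniz b x hx h1 hij, hg]; simp

theorem repr_dd {i j : Fin n} {F : S} (hF : dd b i j F = 0) {w : Sn n} (hw : w j < w i) :
    b.repr F w = 0 := by
  have h := congrArg (fun y => b.repr y (w * Equiv.swap i j)) hF
  rw [← b.sum_repr F] at h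
  simp only [map_sum, map_smul, dd_b] at h
  rw [Finsupp.finsetSum_apply, Finset.sum_eq_single w] at h
  · simpa [hw] using h
  · intro v _ hv
    split_ifs
    · simp [hv]
    · simp
  · simp

/-- parabolic condition -/
def Par (J : Set ℕ) (u : Sn n) : Prop := ∀ i : ℕ, i ∉ J → ∀ a : Fin n, a.val ≤ i ↔ (u a).val ≤ i

theorem par_no_descent {J : Set ℕ} {u : Sn n} (hu : Par J u) {i j : Fin n}
    (hij : i.val + 1 = j.val) (hi : i.val ∉ J) : ¬ u j < u i := by
  have e1 := hu _ hi i
  have e2 := hu _ hi j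
  rw [Fin.lt_def]; omega

theorem par_fix {J : Set ℕ} {u : Sn n} (hu : Par J u) {a : Fin n}
    (h1 : a.val ∉ J) (h2 : ∀ c, c + 1 = a.val → c ∉ J) : u a = a := by
  have e1 := hu _ h1 a
  rw [Fin.ext_iff]
  rcases Nat.eq_zero_or_pos a.val with h | h
  · omega
  · have e2 := hu (a.val - 1) (h2 _ (by omega)) a
    omega

theorem par_mul {J : Set ℕ} {u : Sn n} (hu : Par J u) {i j : Fin n}
    (hij : i.val + 1 = j.val) (hi : i.val ∈ J) : Par J (u * Equiv.swap i j) := by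
  intro c hc a
  rw [Equiv.Perm.mul_apply, ← hu c hc]
  have : c ≠ i.val := by rintro rfl; exact hc hi
  simp only [Equiv.swap_apply_def]
  split_ifs <;> subst_vars <;> omega

theorem par_disj {J K : Set ℕ} (hJK : ∀ a ∈ J, ∀ c ∈ K, a ≠ c ∧ a + 1 ≠ c ∧ c + 1 ≠ a)
    {u v : Sn n} (hu : Par J u) (hv : Par K v) : Equiv.Perm.Disjoint u v := by
  intro a
  by_cases h1 : a.val ∈ J
  · right
    refine par_fix hv (fun h => (hJK _ h1 _ h).1 rfl) (fun c hc h => (hJK _ h1 _ h).2.2 hc)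
  · by_cases h2 : ∃ c, c + 1 = a.val ∧ c ∈ J
    · right
      obtain ⟨c, hc, hcJ⟩ := h2
      refine par_fix hv (fun h => (hJK _ hcJ _ h).2.1 hc) (fun d hd h => (hJK _ hcJ _ h).1 (by omega))
    · left
      push Not at h2
      exact par_fix hu h1 h2

theorem step
    (hx : ∀ k u, x k * b u = ∑ l, coef u k l • b (u * Equiv.swap k l))
    {J K : Set ℕ} (hJK : ∀ a ∈ J, ∀ c ∈ K, a ≠ c ∧ a + 1 ≠ c ∧ c + 1 ≠ a)
    (h1 : b 1 = 1) {u v : Sn n} (hu : Par J u) (hv : Par K v) {i j : Fin n}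
    (hij : i.val + 1 = j.val) (hi : i.val ∈ J)
    (ih : ∀ u' : Sn n, Par J u' → len u' < len u → b u' * b v = b (u' * v)) :
    dd b i j (b u * b v) = dd b i j (b (u * v)) := by
  have hne := ne_of_succ hij
  have vi : v i = i := par_fix hv (fun h => (hJK _ hi _ h).1 rfl) (fun c hc h => (hJK _ hi _ h).2.2 hc)
  have vj : v j = j := par_fix hv (fun h => (hJK _ hi _ h).2.1 hij)
    (fun d hd h => (hJK _ hi _ h).1 (by omega))
  have hv0 : dd b i j (b v) = 0 := by
    rw [dd_b, if_neg]; rw [vi, vj, Fin.lt_def]; omega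
  rw [leibniz' b x hx h1 hij _ _ hv0, dd_b, dd_b]
  simp only [Equiv.Perm.mul_apply, vi, vj]
  split_ifs with hd
  · rw [ih _ (par_mul hu hij hi) (by have := len_down hij hd; omega)]
    rw [mul_assoc, mul_assoc, Equiv.mul_swap_eq_swap_mul, vi, vj]
  · simp

theorem main_product
    (hx : ∀ k u, x k * b u = ∑ l, coef u k l • b (u * Equiv.swap k l))
    {J K : Set ℕ} (hJK : ∀ a ∈ J, ∀ c ∈ K, a ≠ c ∧ a + 1 ≠ c ∧ c + 1 ≠ a)
    (h1 : b 1 = 1)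
    (hgr : ∀ u v : Sn n, b.repr (b u * b v) 1 ≠ 0 → len u + len v = 0) (m : ℕ) :
    ∀ u v : Sn n, len u + len v = m → Par J u → Par K v → b u * b v = b (u * v) := by
  induction m using Nat.strong_induction_on with
  | _ m ih =>
  intro u v hm hu hv
  have hJK' : ∀ a ∈ K, ∀ c ∈ J, a ≠ c ∧ a + 1 ≠ c ∧ c + 1 ≠ a := fun a ha c hc =>
    ⟨(hJK c hc a ha).1.symm, (hJK c hc a ha).2.2, (hJK c hc a ha).2.1⟩
  have hdd : ∀ i j : Fin n, i.val + 1 = j.val → dd b i j (b u * b v - b (u * v)) = 0 := by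
    intro i j hij
    rw [map_sub, sub_eq_zero]
    by_cases hi : i.val ∈ J
    · exact step b x hx hJK h1 hu hv hij hi (fun u' hu' hl => ih _ (by omega) u' v rfl hu' hv)
    by_cases hi' : i.val ∈ K
    · rw [mul_comm (b u), (par_disj hJK hu hv).commute.eq]
      refine step b x hx hJK' h1 hv hu hij hi' (fun v' hv' hl => ?_)
      rw [mul_comm, ih _ (by omega) u v' rfl hu hv', (par_disj hJK hu hv').commute.eq]
    · have z1 : dd b i j (b u) = 0 := by rw [dd_b, if_neg (par_no_descent hu hij hi)]
      have z2 : dd b i j (b v) = 0 := by rw [dd_b, if_neg (par_no_descent hv hij hi')]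
      rw [leibniz' b x hx h1 hij _ _ z2, z1, zero_mul, dd_b, if_neg]
      have : Par (J ∪ K) (u * v) := by
        intro c hc a
        rw [Equiv.Perm.mul_apply, ← hu c (fun h => hc (Or.inl h)), ← hv c (fun h => hc (Or.inr h))]
      exact par_no_descent this hij (fun h => h.elim hi hi')
  by_cases hu1 : u = 1
  · subst hu1; rw [h1, one_mul, one_mul]
  rw [← sub_eq_zero]
  apply b.repr.injective
  rw [map_zero]
  ext w
  by_cases hw : w = 1
  · subst hw
    rw [map_sub, Finsupp.sub_apply]
    have e1 : b.repr (b u * b v) 1 = 0 := by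
      by_contra hc
      have := hgr _ _ hc
      exact hu1 (eq_one_of_len (by omega))
    have e2 : u * v ≠ 1 := by
      rw [Ne, (par_disj hJK hu hv).mul_eq_one_iff]; tauto
    rw [e1]
    simp [e2]
  · obtain ⟨i, j, hij, hd⟩ := exists_descent hw
    exact repr_dd b (hdd i j hij) hd

end alg

theorem swap_eq {u : Sn n} {a c a' c' : Fin n} (h : a < c) (h' : a' < c')
    (e : u * Equiv.swap a c = u * Equiv.swap a' c') : a = a' ∧ c = c' := by
  have e := mul_left_cancel e
  have e1 := congrArg (fun f : Sn n => f a) e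
  have e2 := congrArg (fun f : Sn n => f c) e
  simp only [Equiv.swap_apply_left, Equiv.swap_apply_right] at e1 e2
  simp only [Equiv.swap_apply_def] at e1 e2
  split_ifs at e1 e2 <;> simp only [Fin.lt_def, Fin.ext_iff] at * <;> omega

theorem monk_sum {S : Type} [CommRing S] (b : Sn n → S) (u : Sn n) (r : ℕ) :
    (∑ w : Sn n, (if ∃ a c : Fin n, a.val ≤ r ∧ r < c.val ∧
            w = u * Equiv.swap a c ∧ len w = len u + 1 then (1 : ℤ) else 0) • b w) =
    ∑ a : Fin n, ∑ c : Fin n, if a.val ≤ r ∧ r < c.val then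
      (if len (u * Equiv.swap a c) = len u + 1 then b (u * Equiv.swap a c) else 0) else 0 := by
  rw [← Fintype.sum_prod_type']
  simp only [ite_smul, one_smul, zero_smul, ← ite_and]
  rw [← Finset.sum_filter, ← Finset.sum_filter]
  symm
  refine Finset.sum_bij (fun p _ => u * Equiv.swap p.1 p.2) ?_ ?_ ?_ ?_
  · rintro ⟨a, c⟩ h
    simp only [Finset.mem_filter, Finset.mem_univ, true_and] at h ⊢
    exact ⟨a, c, h.1.1, h.1.2, rfl, h.2⟩
  · rintro ⟨a, c⟩ h ⟨a', c'⟩ h' e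
    dsimp only at e
    simp only [Finset.mem_filter, Finset.mem_univ, true_and] at h h'
    have := swap_eq (by rw [Fin.lt_def]; omega) (by rw [Fin.lt_def]; omega) e
    rw [this.1, this.2]
  · rintro w h
    simp only [Finset.mem_filter, Finset.mem_univ, true_and] at h
    obtain ⟨a, c, h1, h2, rfl, h3⟩ := h
    exact ⟨(a, c), by simp [h1, h2, h3], rfl⟩
  · intros; rfl

/-- divisor class, zero outside the range -/
noncomputable def Dv {S : Type} [CommRing S] (b : Sn n → S) (r : ℕ) : S :=
  if h : r + 1 < n then b (simpleRefl n r h) else 0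

/-- the classes `x_k` -/
noncomputable def Xv {S : Type} [CommRing S] (b : Sn n → S) (k : Fin n) : S :=
  Dv b k.val - (if k.val = 0 then 0 else Dv b (k.val - 1))

theorem Xv_mul {S : Type} [CommRing S] (b : Sn n → S)
    (hM : ∀ (r : ℕ) (h : r + 1 < n) (u : Sn n),
      b (simpleRefl n r h) * b u =
        ∑ w : Sn n, (if ∃ a c : Fin n, a.val ≤ r ∧ r < c.val ∧
            w = u * Equiv.swap a c ∧ len w = len u + 1 then (1 : ℤ) else 0) • b w)
    (k : Fin n) (u : Sn n) :
    Xv b k * b u = ∑ l, coef u k l • b (u * Equiv.swap k l) := by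
  set C : Fin n → Fin n → S := fun a c =>
    if len (u * Equiv.swap a c) = len u + 1 then b (u * Equiv.swap a c) else 0 with hC
  have hD : ∀ r, Dv b r * b u = ∑ a : Fin n, ∑ c : Fin n,
      if a.val ≤ r ∧ r < c.val then C a c else 0 := by
    intro r
    unfold Dv
    split_ifs with h
    · rw [hM, monk_sum]
    · rw [zero_mul]
      symm
      refine Finset.sum_eq_zero fun a _ => Finset.sum_eq_zero fun c _ => if_neg ?_
      have := c.isLt
      omega
  have hD' : (if k.val = 0 then 0 else Dv b (k.val - 1)) * b u = ∑ a : Fin n, ∑ c : Fin n,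
      if a.val < k.val ∧ k.val ≤ c.val then C a c else 0 := by
    split_ifs with h
    · rw [zero_mul]
      symm
      refine Finset.sum_eq_zero fun a _ => Finset.sum_eq_zero fun c _ => if_neg ?_
      omega
    · rw [hD]
      refine Finset.sum_congr rfl fun a _ => Finset.sum_congr rfl fun c _ => ?_
      exact if_congr (by omega) rfl rfl
  have hdiff : Xv b k * b u = ∑ a : Fin n, ∑ c : Fin n,
      ((if a = k then (if k < c then C k c else 0) else 0) -
        (if c = k then (if a < k then C a k else 0) else 0)) := by
    rw [Xv, sub_mul, hD, hD', ← Finset.sum_sub_distrib]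
    refine Finset.sum_congr rfl fun a _ => ?_
    rw [← Finset.sum_sub_distrib]
    refine Finset.sum_congr rfl fun c _ => ?_
    by_cases h1 : a = k
    · subst h1
      by_cases h2 : c = a
      · subst h2; simp
      · simp [h2]
    · by_cases h2 : c = k
      · subst h2
        simp [h1]
      · rw [if_neg h1, if_neg h2]
        have hiff : (a.val ≤ k.val ∧ k.val < c.val) ↔ (a.val < k.val ∧ k.val ≤ c.val) := by
          simp only [Fin.ext_iff] at h1 h2; omega
        rw [if_congr hiff rfl rfl]
        simp
  rw [hdiff]
  simp only [Finset.sum_sub_distrib]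
  rw [Finset.sum_comm]
  simp only [Finset.sum_ite_eq', Finset.mem_univ, if_true]
  rw [← Finset.sum_sub_distrib]
  refine Finset.sum_congr rfl fun l _ => ?_
  simp only [hC, coef, Equiv.swap_comm l k]
  rcases lt_trichotomy k l with h | h | h
  · simp [h, h.not_gt]
  · simp [h]
  · simp [h, h.not_gt]; split_ifs <;> simp

theorem par_word (L : List (Fin (n - 1))) :
    Par {r | ∃ i ∈ L, i.val = r} ((L.map (sref n)).prod) := by
  induction L with
  | nil => intro i _ a; simp
  | cons t L ih =>
    intro i hi a
    simp only [Set.mem_ofPred_eq, List.mem_cons, not_exists, not_and] at hi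
    rw [List.map_cons, List.prod_cons, Equiv.Perm.mul_apply,
      ih i (by rintro ⟨c, hc, e⟩; exact hi c (Or.inr hc) e) a]
    have := hi t (Or.inl rfl)
    generalize ((L.map (sref n)).prod) a = y
    simp only [sref, Equiv.swap_apply_def]
    split_ifs with h1 h2 <;> simp only [Fin.ext_iff] at * <;> omega

theorem comm_far {r s : Fin (n - 1)} (hne : r ≠ s) (hc : Commute (sref n r) (sref n s)) :
    r.val ≠ s.val ∧ r.val + 1 ≠ s.val ∧ s.val + 1 ≠ r.val := by
  have hr := r.isLt
  have hs := s.isLt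
  refine ⟨fun h => hne (Fin.ext h), fun h => ?_, fun h => ?_⟩
  · have := congrArg (fun f : Sn n => (f ⟨r.val, by omega⟩).val) hc.eq
    simp only [Equiv.Perm.mul_apply, sref, Equiv.swap_apply_def, Fin.ext_iff] at this
    split_ifs at this <;> simp at * <;> omega
  · have := congrArg (fun f : Sn n => (f ⟨s.val, by omega⟩).val) hc.eq
    simp only [Equiv.Perm.mul_apply, sref, Equiv.swap_apply_def, Fin.ext_iff] at this
    split_ifs at this <;> simp at * <;> omega

theorem final_coeff (N : Sn n → Sn n → Sn n → ℤ)
    (hN : IsSchubertConstants n N) (J K : Set ℕ)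
    (hJK : ∀ a ∈ J, ∀ c ∈ K, a ≠ c ∧ a + 1 ≠ c ∧ c + 1 ≠ a)
    (u v : Sn n) (hu : Par J u) (hv : Par K v) (w : Sn n) :
    N u v w = if w = u * v then 1 else 0 := by
  obtain ⟨A, _, σ, hli, h1, hmul, hgr, hM⟩ := hN
  let B : Subalgebra ℤ A := (Submodule.span ℤ (Set.range σ)).toSubalgebra
    (h1 ▸ Submodule.subset_span ⟨1, rfl⟩) (by
      intro y z hy hz
      have := Submodule.mul_mem_mul hy hz
      rw [Submodule.span_mul_span] at this
      refine Submodule.span_le.2 ?_ this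
      rintro _ ⟨_, ⟨p, rfl⟩, _, ⟨q, rfl⟩, rfl⟩
      simp only [SetLike.mem_coe, hmul]
      exact sum_mem fun w _ => Submodule.smul_mem _ _ (Submodule.subset_span ⟨w, rfl⟩))
  have hmem : ∀ w, σ w ∈ B := fun w => Submodule.subset_span ⟨w, rfl⟩
  let τ : Sn n → B := fun w => ⟨σ w, hmem w⟩
  have hτ : ∀ w, B.val.toLinearMap (τ w) = σ w := fun w => rfl
  have hinj : Function.Injective B.val.toLinearMap := Subtype.val_injective
  have hτli : LinearIndependent ℤ τ := LinearIndependent.of_comp B.val.toLinearMap hli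
  have hspan : ⊤ ≤ Submodule.span ℤ (Set.range τ) := by
    rintro ⟨y, hy⟩ -
    have hy' : y ∈ Submodule.span ℤ (Set.range σ) := hy
    have e : Set.range σ = B.val.toLinearMap '' (Set.range τ) := by
      rw [← Set.range_comp]; rfl
    rw [e, Submodule.span_image] at hy'
    obtain ⟨z, hz, hzy⟩ := hy'
    have : z = ⟨y, hy⟩ := hinj hzy
    rwa [← this]
  let b : Module.Basis (Sn n) ℤ B := Module.Basis.mk hτli hspan
  have hb : ∀ w, b w = τ w := fun w => by simp [b]
  have hbmul : ∀ p q, b p * b q = ∑ w, N p q w • b w := by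
    intro p q
    apply hinj
    simp only [hb, map_sum, map_smul, hτ]
    exact hmul p q
  have hrepr : ∀ p q w, b.repr (b p * b q) w = N p q w := by
    intro p q w
    rw [hbmul, b.repr_sum_self]
  have hb1 : b 1 = 1 := by
    apply hinj; rw [hb, hτ, h1]; rfl
  have hbM : ∀ (r : ℕ) (h : r + 1 < n) (u : Sn n),
      b (simpleRefl n r h) * b u =
        ∑ w : Sn n, (if ∃ a c : Fin n, a.val ≤ r ∧ r < c.val ∧
            w = u * Equiv.swap a c ∧ len w = len u + 1 then (1 : ℤ) else 0) • b w := by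
    intro r h u
    apply hinj
    simp only [hb, map_sum, map_smul, hτ]
    exact hM r h u
  have := main_product b (Xv b) (Xv_mul b hbM) hJK hb1 (by
    intro p q hpq
    rw [hrepr] at hpq
    have := hgr _ _ _ hpq
    rw [len_one] at this
    omega) _ u v rfl hu hv
  rw [← hrepr, this]
  simp [Finsupp.single_apply, eq_comm]

end SchubAux

/-- If `u = u_1 u_2` where `u_1, u_2` have positive length, the simple reflections occurring
in reduced expressions of `u_1` and of `u_2` are disjoint, and every simple reflection used
in `u_1` commutes with every one used in `u_2` (property (⋆) at level 2), then
`σ^{u_1} ∪ σ^{u_2} = σ^u`; equivalently `N_{u_1,u_2}^{u_1 u_2} = 1` and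
`N_{u_1,u_2}^w = 0` for all `w ≠ u_1 u_2`. -/
theorem schubert_product_of_disjoint_supports (n : ℕ) (N : Sn n → Sn n → Sn n → ℤ)
    (hN : IsSchubertConstants n N) (u u1 u2 : Sn n) (hu : u = u1 * u2)
    (h1 : 1 ≤ len u1) (h2 : 1 ≤ len u2)
    (L1 L2 : List (Fin (n - 1)))
    (hL1 : IsReducedWord n u1 L1) (hL2 : IsReducedWord n u2 L2)
    (hdisj : ∀ r ∈ L1, ∀ r' ∈ L2, r ≠ r')
    (hcomm : ∀ r ∈ L1, ∀ r' ∈ L2, Commute (sref n r) (sref n r')) :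
    N u1 u2 u = 1 ∧ ∀ w : Sn n, w ≠ u → N u1 u2 w = 0 := by
  have h := SchubAux.final_coeff N hN _ _ (by
    rintro _ ⟨r, hr, rfl⟩ _ ⟨s, hs, rfl⟩
    exact SchubAux.comm_far (hdisj r hr s hs) (hcomm r hr s hs)) u1 u2
    (hL1.2 ▸ SchubAux.par_word L1) (hL2.2 ▸ SchubAux.par_word L2)
  refine ⟨by rw [h, if_pos hu], fun w hw => by rw [h, if_neg (hu ▸ hw)]⟩
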